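/- Let (V, R, T, 𝔤) be a generalized symmetric holonomy system such that R vanishes on the image of T, i.e. (R(a,b))(T(c,d)) = 0 and R(a, T(b,c)) = 0 for all a, b, c, d ∈ V. If B′(x,y) = 0 for all x, y ∈ V, then R(x,y) = 0 for all x, y ∈ V. -/

import Mathlib

open RealInnerProductSpace

/-- The bracket on 𝔍 = 𝔤 ⊕ V for a generalized symmetric holonomy system:
`[(A,x),(A′,y)] = ([A,A′] − R(x,y), A(y) − A′(x) − T(x,y))`. -/
def brkJ {V : Type} [NormedAddCommGroup V] [InnerProductSpace ℝ V]
    (g : Submodule ℝ (V →ₗ[ℝ] V))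
    (hg : ∀ A ∈ g, ∀ B ∈ g, A ∘ₗ B - B ∘ₗ A ∈ g)
    (R : V →ₗ[ℝ] V →ₗ[ℝ] (V →ₗ[ℝ] V)) (hR : ∀ x y : V, R x y ∈ g)
    (T : V →ₗ[ℝ] V →ₗ[ℝ] V) :
    (↥g × V) → (↥g × V) → (↥g × V) :=
  fun u v =>
    (⟨u.1.1 ∘ₗ v.1.1 - v.1.1 ∘ₗ u.1.1 - R u.2 v.2,
      sub_mem (hg _ u.1.2 _ v.1.2) (hR u.2 v.2)⟩,
     u.1.1 v.2 - v.1.1 u.2 - T u.2 v.2)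

/-- `ad_u : 𝔍 → 𝔍`, as a linear map. -/
def adJ {V : Type} [NormedAddCommGroup V] [InnerProductSpace ℝ V]
    (g : Submodule ℝ (V →ₗ[ℝ] V))
    (hg : ∀ A ∈ g, ∀ B ∈ g, A ∘ₗ B - B ∘ₗ A ∈ g)
    (R : V →ₗ[ℝ] V →ₗ[ℝ] (V →ₗ[ℝ] V)) (hR : ∀ x y : V, R x y ∈ g)
    (T : V →ₗ[ℝ] V →ₗ[ℝ] V) (u : ↥g × V) :
    (↥g × V) →ₗ[ℝ] (↥g × V) where
  toFun v := brkJ g hg R hR T u v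
  map_add' v w := by
    refine Prod.ext (Subtype.ext ?_) ?_ <;>
      simp [brkJ, LinearMap.comp_add, LinearMap.add_comp] <;> abel
  map_smul' c v := by
    refine Prod.ext (Subtype.ext ?_) ?_ <;>
      simp [brkJ, LinearMap.comp_smul, LinearMap.smul_comp, smul_sub] <;> abel

/-- The form `B′(u,v) = tr(ad_u ∘ ad_v)` on 𝔍. -/
noncomputable def Bform {V : Type} [NormedAddCommGroup V] [InnerProductSpace ℝ V]
    (g : Submodule ℝ (V →ₗ[ℝ] V))
    (hg : ∀ A ∈ g, ∀ B ∈ g, A ∘ₗ B - B ∘ₗ A ∈ g)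
    (R : V →ₗ[ℝ] V →ₗ[ℝ] (V →ₗ[ℝ] V)) (hR : ∀ x y : V, R x y ∈ g)
    (T : V →ₗ[ℝ] V →ₗ[ℝ] V) (u v : ↥g × V) : ℝ :=
  LinearMap.trace ℝ (↥g × V) (adJ g hg R hR T u ∘ₗ adJ g hg R hR T v)

/-- The trace of the square of a skew-adjoint operator is nonpositive. -/
lemma trace_comp_self_nonpos_of_skew {E : Type*} [NormedAddCommGroup E] [InnerProductSpace ℝ E]
    [FiniteDimensional ℝ E] (f : E →ₗ[ℝ] E) (hf : ∀ x y : E, ⟪f x, y⟫ = -⟪x, f y⟫) :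
    LinearMap.trace ℝ E (f ∘ₗ f) ≤ 0 := by
  rw [LinearMap.trace_eq_sum_inner _ (stdOrthonormalBasis ℝ E)]
  refine Finset.sum_nonpos fun i _ => ?_
  rw [LinearMap.comp_apply, ← neg_neg (inner ℝ _ _), ← hf, neg_nonpos]
  exact real_inner_self_nonneg

/-- A skew-adjoint operator whose square is traceless is zero. -/
lemma eq_zero_of_skew_of_trace_comp_self_eq_zero {E : Type*} [NormedAddCommGroup E]
    [InnerProductSpace ℝ E] [FiniteDimensional ℝ E] (f : E →ₗ[ℝ] E)
    (hf : ∀ x y : E, ⟪f x, y⟫ = -⟪x, f y⟫) (htr : LinearMap.trace ℝ E (f ∘ₗ f) = 0) :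
    f = 0 := by
  let e := stdOrthonormalBasis ℝ E
  have hsum : ∑ i, ⟪f (e i), f (e i)⟫ = 0 := by
    rw [LinearMap.trace_eq_sum_inner _ e] at htr
    simp only [hf, Finset.sum_neg_distrib, neg_eq_zero]
    exact htr
  rw [Finset.sum_eq_zero_iff_of_nonneg fun i _ => real_inner_self_nonneg] at hsum
  refine e.toBasis.ext fun i => ?_
  simpa using hsum i (Finset.mem_univ i)

/-- An operator that is skew for a positive definite symmetric bilinear form and whose square is
traceless is zero. -/
lemma eq_zero_of_skew_form_of_trace_comp_self_eq_zero {E : Type*} [AddCommGroup E] [Module ℝ E]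
    [FiniteDimensional ℝ E] (b : E →ₗ[ℝ] E →ₗ[ℝ] ℝ) (hsymm : ∀ x y, b x y = b y x)
    (hnonneg : ∀ x, 0 ≤ b x x) (hdef : ∀ x, b x x = 0 → x = 0) (f : E →ₗ[ℝ] E)
    (hf : ∀ x y : E, b (f x) y = -b x (f y)) (htr : LinearMap.trace ℝ E (f ∘ₗ f) = 0) :
    f = 0 := by
  let core : InnerProductSpace.Core ℝ E :=
    { inner := fun x y => b x y
      conj_inner_symm := fun x y => hsymm y x
      re_inner_nonneg := hnonneg
      add_left := fun x y z => by simp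
      smul_left := fun x y r => by simp
      definite := hdef }
  let _ : NormedAddCommGroup E := core.toNormedAddCommGroup
  let _ : InnerProductSpace ℝ E := InnerProductSpace.ofCore core.toCore
  exact eq_zero_of_skew_of_trace_comp_self_eq_zero f hf htr

/-- If `[p, q] = -a - r` with `a ∘ r = 0`, then `tr(a²) = -tr([a, p] ∘ q)`; in particular the former
vanishes if the latter does. -/
lemma trace_comp_self_eq_zero_of_commutators {E : Type*} [AddCommGroup E] [Module ℝ E]
    {a p q r s : E →ₗ[ℝ] E} (hs : s = a ∘ₗ p - p ∘ₗ a)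
    (hpq : p ∘ₗ q - q ∘ₗ p = -a - r) (har : a ∘ₗ r = 0)
    (htr : LinearMap.trace ℝ E (s ∘ₗ q) = 0) : LinearMap.trace ℝ E (a ∘ₗ a) = 0 := by
  have hcycle := LinearMap.trace_mul_cycle ℝ p a q
  have hcycle' := LinearMap.trace_mul_cycle ℝ q p a
  have hcomp := congrArg (fun f => LinearMap.trace ℝ E (a ∘ₗ f)) hpq
  simp only [Module.End.mul_eq_comp, LinearMap.comp_assoc] at hcycle hcycle'
  simp only [LinearMap.comp_sub, LinearMap.comp_neg, har, map_sub, map_neg, map_zero] at hcomp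
  rw [hs, LinearMap.sub_comp, map_sub, LinearMap.comp_assoc, LinearMap.comp_assoc] at htr
  linarith

/-- The bilinear form `((A,x),(B,y)) ↦ -tr(A ∘ B) + ⟪x, y⟫` on `𝔤 ⊕ V`. -/
noncomputable def formJ {V : Type} [NormedAddCommGroup V] [InnerProductSpace ℝ V]
    (g : Submodule ℝ (V →ₗ[ℝ] V)) : (↥g × V) →ₗ[ℝ] (↥g × V) →ₗ[ℝ] ℝ :=
  LinearMap.mk₂ ℝ (fun u v => -LinearMap.trace ℝ V (u.1.1 ∘ₗ v.1.1) + ⟪u.2, v.2⟫)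
    (fun u u' v => by simp [LinearMap.add_comp, inner_add_left]; ring)
    (fun c u v => by simp [LinearMap.smul_comp, inner_smul_left]; ring)
    (fun u v v' => by simp [LinearMap.comp_add, inner_add_right]; ring)
    (fun c u v => by simp [LinearMap.comp_smul, inner_smul_right]; ring)

lemma formJ_apply {V : Type} [NormedAddCommGroup V] [InnerProductSpace ℝ V]
    (g : Submodule ℝ (V →ₗ[ℝ] V)) (u v : ↥g × V) :
    formJ g u v = -LinearMap.trace ℝ V (u.1.1 ∘ₗ v.1.1) + ⟪u.2, v.2⟫ := rfl

lemma formJ_self_nonneg {V : Type} [NormedAddCommGroup V] [InnerProductSpace ℝ V]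
    [FiniteDimensional ℝ V] (g : Submodule ℝ (V →ₗ[ℝ] V))
    (hg_skew : ∀ A ∈ g, ∀ x y : V, ⟪A x, y⟫ = -⟪x, A y⟫) (u : ↥g × V) :
    0 ≤ formJ g u u := by
  have h1 := trace_comp_self_nonpos_of_skew u.1.1 (hg_skew _ u.1.2)
  have h2 : 0 ≤ ⟪u.2, u.2⟫ := real_inner_self_nonneg
  rw [formJ_apply]
  linarith

lemma eq_zero_of_formJ_self_eq_zero {V : Type} [NormedAddCommGroup V] [InnerProductSpace ℝ V]
    [FiniteDimensional ℝ V] (g : Submodule ℝ (V →ₗ[ℝ] V))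
    (hg_skew : ∀ A ∈ g, ∀ x y : V, ⟪A x, y⟫ = -⟪x, A y⟫) (u : ↥g × V)
    (hu : formJ g u u = 0) : u = 0 := by
  have h1 := trace_comp_self_nonpos_of_skew u.1.1 (hg_skew _ u.1.2)
  have h2 : 0 ≤ ⟪u.2, u.2⟫ := real_inner_self_nonneg
  rw [formJ_apply] at hu
  refine Prod.ext (Subtype.ext ?_) ?_
  · exact eq_zero_of_skew_of_trace_comp_self_eq_zero _ (hg_skew _ u.1.2) (by linarith)
  · exact inner_self_eq_zero.mp (show ⟪u.2, u.2⟫ = 0 by linarith)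

section

variable {V : Type} [NormedAddCommGroup V] [InnerProductSpace ℝ V]
  (g : Submodule ℝ (V →ₗ[ℝ] V))
  (hg_lie : ∀ A ∈ g, ∀ B ∈ g, A ∘ₗ B - B ∘ₗ A ∈ g)
  (R : V →ₗ[ℝ] V →ₗ[ℝ] (V →ₗ[ℝ] V)) (hRg : ∀ x y : V, R x y ∈ g)
  (T : V →ₗ[ℝ] V →ₗ[ℝ] V)

lemma adJ_apply_fst (u v : ↥g × V) :
    ((adJ g hg_lie R hRg T u v).1 : V →ₗ[ℝ] V) =
      u.1.1 ∘ₗ v.1.1 - v.1.1 ∘ₗ u.1.1 - R u.2 v.2 := rfl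

lemma adJ_apply_snd (u v : ↥g × V) :
    (adJ g hg_lie R hRg T u v).2 = u.1.1 v.2 - v.1.1 u.2 - T u.2 v.2 := rfl

/-- For `A ∈ 𝔤`, the operator `ad_A` is skew for `formJ`. -/
lemma formJ_adJ_skew (hg_skew : ∀ A ∈ g, ∀ x y : V, ⟪A x, y⟫ = -⟪x, A y⟫)
    (A : ↥g) (u v : ↥g × V) :
    formJ g (adJ g hg_lie R hRg T (A, 0) u) v =
      -formJ g u (adJ g hg_lie R hRg T (A, 0) v) := by
  have h1 := LinearMap.trace_mul_cycle ℝ A.1 u.1.1 v.1.1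
  have h2 := LinearMap.trace_mul_cycle ℝ u.1.1 A.1 v.1.1
  have h3 := LinearMap.trace_mul_cycle ℝ u.1.1 v.1.1 A.1
  simp only [Module.End.mul_eq_comp, LinearMap.comp_assoc] at h1 h2 h3
  simp only [formJ_apply, adJ_apply_fst, adJ_apply_snd, map_zero, LinearMap.zero_apply,
    sub_zero, LinearMap.sub_comp, LinearMap.comp_sub, map_sub, hg_skew _ A.2,
    LinearMap.comp_assoc]
  linarith

/-- The Jacobi identity for `A ∈ 𝔤` and `x ∈ V`: `ad_{Ax} = [ad_A, ad_x]`. -/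
lemma adJ_apply_eq_commutator
    (hS1 : ∀ A ∈ g, ∀ x y : V,
      A ∘ₗ R x y - R x y ∘ₗ A = R (A x) y + R x (A y))
    (hS2 : ∀ A ∈ g, ∀ x y : V, A (T x y) = T (A x) y + T x (A y)) (A : ↥g) (x : V) :
    adJ g hg_lie R hRg T (0, A.1 x) =
      adJ g hg_lie R hRg T (A, 0) ∘ₗ adJ g hg_lie R hRg T (0, x) -
        adJ g hg_lie R hRg T (0, x) ∘ₗ adJ g hg_lie R hRg T (A, 0) := by
  refine LinearMap.ext fun w => Prod.ext (Subtype.ext ?_) ?_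
  · have h := hS1 _ A.2 x w.2
    simp [adJ_apply_fst, adJ_apply_snd, LinearMap.comp_neg, LinearMap.neg_comp]
    rw [← sub_eq_iff_eq_add] at h
    rw [← h]
    abel
  · have h := hS2 _ A.2 x w.2
    simp [adJ_apply_fst, adJ_apply_snd, h]
    abel

/-- The Jacobi identity for `x, y ∈ V`: `[ad_x, ad_y] = -ad_{R(x,y)} - ad_{T(x,y)}`. -/
lemma commutator_adJ_eq (hRalt : ∀ x : V, R x x = 0) (hTalt : ∀ x : V, T x x = 0)
    (hB1 : ∀ x y z : V,
      R x y z + T x (T y z) + R y z x + T y (T z x) + R z x y + T z (T x y) = 0)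
    (hB2 : ∀ x y z : V, R x (T y z) + R y (T z x) + R z (T x y) = 0)
    (hS1 : ∀ A ∈ g, ∀ x y : V,
      A ∘ₗ R x y - R x y ∘ₗ A = R (A x) y + R x (A y))
    (hS2 : ∀ A ∈ g, ∀ x y : V, A (T x y) = T (A x) y + T x (A y)) (x y : V) :
    adJ g hg_lie R hRg T (0, x) ∘ₗ adJ g hg_lie R hRg T (0, y) -
        adJ g hg_lie R hRg T (0, y) ∘ₗ adJ g hg_lie R hRg T (0, x) =
      -adJ g hg_lie R hRg T (⟨R x y, hRg x y⟩, 0) - adJ g hg_lie R hRg T (0, T x y) := by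
  have hRs : ∀ a b, R a b = -R b a := fun a b => (LinearMap.IsAlt.neg hRalt b a).symm
  have hTs : ∀ a b, T a b = -T b a := fun a b => (LinearMap.IsAlt.neg hTalt b a).symm
  refine LinearMap.ext fun w => Prod.ext (Subtype.ext ?_) ?_
  · have h := hS1 _ w.1.2 x y
    have h2 := hB2 x y w.2
    rw [hRs w.2, hTs w.2 x, map_neg] at h2
    simp [adJ_apply_fst, adJ_apply_snd]
    rw [hRs y (w.1.1 x)]
    rw [sub_eq_iff_eq_add] at h
    rw [h]
    rw [add_neg_eq_zero] at h2
    rw [← h2]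
    abel
  · have h := hS2 _ w.1.2 x y
    have h2 := hB1 x y w.2
    rw [hTs w.2 x, hTs w.2 (T x y), hRs w.2 x, map_neg] at h2
    simp [adJ_apply_fst, adJ_apply_snd, h]
    rw [hTs y (w.1.1 x)]
    simp only [LinearMap.neg_apply] at h2
    rw [add_neg_eq_zero] at h2
    rw [← h2]
    abel

/-- `ad_{R(a,b)} ∘ ad_{T(c,d)} = 0` when the curvature vanishes on the image of the torsion. -/
lemma adJ_curvature_comp_adJ_torsion
    (hS2 : ∀ A ∈ g, ∀ x y : V, A (T x y) = T (A x) y + T x (A y))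
    (hRT1 : ∀ a b c d : V, R a b (T c d) = 0)
    (hRT3 : ∀ a b c : V, R (T b c) a = 0) (a b c d : V) :
    adJ g hg_lie R hRg T (⟨R a b, hRg a b⟩, 0) ∘ₗ adJ g hg_lie R hRg T (0, T c d) = 0 := by
  refine LinearMap.ext fun w => Prod.ext (Subtype.ext ?_) ?_
  · simp [adJ_apply_fst, adJ_apply_snd, hRT3]
  · simp [adJ_apply_fst, adJ_apply_snd, hRT1, hRT3, hS2 _ w.1.2]

end

/-- For a generalized symmetric holonomy system whose curvature vanishes on the image
of the torsion, if `B′` vanishes identically on `V`, then the curvature vanishes. -/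
theorem curvature_zero_of_Bform_V_zero
    {V : Type} [NormedAddCommGroup V] [InnerProductSpace ℝ V]
    [FiniteDimensional ℝ V] [Nontrivial V]
    (g : Submodule ℝ (V →ₗ[ℝ] V))
    (hg_lie : ∀ A ∈ g, ∀ B ∈ g, A ∘ₗ B - B ∘ₗ A ∈ g)
    (hg_skew : ∀ A ∈ g, ∀ x y : V, ⟪A x, y⟫ = -⟪x, A y⟫)
    (R : V →ₗ[ℝ] V →ₗ[ℝ] (V →ₗ[ℝ] V)) (hRg : ∀ x y : V, R x y ∈ g)
    (hRalt : ∀ x : V, R x x = 0)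
    (T : V →ₗ[ℝ] V →ₗ[ℝ] V) (hTalt : ∀ x : V, T x x = 0)
    (hB1 : ∀ x y z : V,
      R x y z + T x (T y z) + R y z x + T y (T z x) + R z x y + T z (T x y) = 0)
    (hB2 : ∀ x y z : V, R x (T y z) + R y (T z x) + R z (T x y) = 0)
    (hS1 : ∀ A ∈ g, ∀ x y : V,
      A ∘ₗ R x y - R x y ∘ₗ A = R (A x) y + R x (A y))
    (hS2 : ∀ A ∈ g, ∀ x y : V, A (T x y) = T (A x) y + T x (A y))
    (hRT1 : ∀ a b c d : V, R a b (T c d) = 0)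
    (hRT2 : ∀ a b c : V, R a (T b c) = 0)
    (hBV : ∀ x y : V, Bform g hg_lie R hRg T ((0 : ↥g), x) ((0 : ↥g), y) = 0) :
    ∀ x y : V, R x y = 0 := by
  intro x y
  have hRT3 : ∀ a b c : V, R (T b c) a = 0 := fun a b c => by
    rw [← LinearMap.IsAlt.neg hRalt, hRT2, neg_zero]
  let ad := adJ g hg_lie R hRg T
  let A : ↥g := ⟨R x y, hRg x y⟩
  have hAx : ad (0, R x y x) = ad (A, 0) ∘ₗ ad (0, x) - ad (0, x) ∘ₗ ad (A, 0) :=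
    adJ_apply_eq_commutator g hg_lie R hRg T hS1 hS2 A x
  have hxy : ad (0, x) ∘ₗ ad (0, y) - ad (0, y) ∘ₗ ad (0, x) = -ad (A, 0) - ad (0, T x y) :=
    commutator_adJ_eq g hg_lie R hRg T hRalt hTalt hB1 hB2 hS1 hS2 x y
  have hRT : ad (A, 0) ∘ₗ ad (0, T x y) = 0 :=
    adJ_curvature_comp_adJ_torsion g hg_lie R hRg T hS2 hRT1 hRT3 x y x y
  have htr : LinearMap.trace ℝ (↥g × V) (ad (A, 0) ∘ₗ ad (A, 0)) = 0 :=
    trace_comp_self_eq_zero_of_commutators hAx hxy hRT (hBV (R x y x) y)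
  have had : ad (A, 0) = 0 :=
    eq_zero_of_skew_form_of_trace_comp_self_eq_zero (formJ g)
      (fun u v => by
        rw [formJ_apply, formJ_apply, LinearMap.trace_comp_comm', real_inner_comm])
      (formJ_self_nonneg g hg_skew) (eq_zero_of_formJ_self_eq_zero g hg_skew) _
      (formJ_adJ_skew g hg_lie R hRg T hg_skew A) htr
  refine LinearMap.ext fun z => ?_
  simpa [ad, A, adJ_apply_snd] using congrArg Prod.snd (LinearMap.congr_fun had (0, z))
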